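/- arXiv:math/0701116 — 3 statements merged into one kernel-verified Lean document; each statement's English description precedes it below -/
import Mathlib

section
/- Let 𝔤 = {X ∈ M₄(ℝ) : XᵀG₄ + G₄X = 0}, whose elements are exactly X(a,b,c,d,e,f) = [[a,b,e,0],[c,d,0,e],[f,0,−d,b],[0,f,c,−a]]. Define the linear map σ : 𝔤 → M₃(ℝ) by σ(X) = [[a−d, 0, √2·b],[0, d−a, √2·c],[√2·c, √2·b, 0]]. Then (i) σ preserves Lie brackets: σ([X,Y]) = [σ(X), σ(Y)] for all X,Y ∈ 𝔤; (ii) the image of σ is exactly 𝔥 = {Y ∈ M₃(ℝ) : Yᵀh + hY = 0}; (iii) the kernel of σ is {X(a,b,c,d,e,f) : a = d, b = c = 0}, i.e. the summand corresponding to the second 𝔰𝔩(2,ℝ) factor. (This is the representation of 𝔰𝔬(2,2) induced on the space Λ⁻ of anti-self-dual bivectors expressed in the frame ψ₁, ψ₂, ψ₃.) -/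
open Matrix

noncomputable def G4 : Matrix (Fin 4) (Fin 4) ℝ :=
  !![0, 0, 0, 1;
     0, 0, -1, 0;
     0, -1, 0, 0;
     1, 0, 0, 0]

/-- The Gram matrix `h` of the induced metric on `Λ⁻` in the frame `ψ₁, ψ₂, ψ₃`. -/
def hmat : Matrix (Fin 3) (Fin 3) ℝ := !![0, 1, 0; 1, 0, 0; 0, 0, -1]

/-- The linear map `σ` on `𝔤 = 𝔰𝔬(2,2)` (reading `a = X₀₀, b = X₀₁, c = X₁₀, d = X₁₁`):
`σ(X) = [[a−d, 0, √2·b],[0, d−a, √2·c],[√2·c, √2·b, 0]]`. -/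
noncomputable def sigmaMap (X : Matrix (Fin 4) (Fin 4) ℝ) : Matrix (Fin 3) (Fin 3) ℝ :=
  !![X 0 0 - X 1 1, 0, Real.sqrt 2 * X 0 1;
     0, X 1 1 - X 0 0, Real.sqrt 2 * X 1 0;
     Real.sqrt 2 * X 1 0, Real.sqrt 2 * X 0 1, 0]

/-- The entrywise equations that define `𝔤 = 𝔰𝔬(2,2)`. -/
lemma transpose_mul_G4_add_eq_zero_iff (X : Matrix (Fin 4) (Fin 4) ℝ) :
    Xᵀ * G4 + G4 * X = 0 ↔
      X = !![X 0 0, X 0 1, X 0 2, 0;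
             X 1 0, X 1 1, 0, X 0 2;
             X 2 0, 0, -X 1 1, X 0 1;
             0, X 2 0, X 1 0, -X 0 0] := by
  simp only [← Matrix.ext_iff, Fin.forall_fin_succ, G4]
  simp [Matrix.mul_apply, vecMul, dotProduct, Fin.sum_univ_succ]
  grind

/-- The entrywise equations that define `𝔥`. -/
lemma transpose_mul_hmat_add_eq_zero_iff (Z : Matrix (Fin 3) (Fin 3) ℝ) :
    Zᵀ * hmat + hmat * Z = 0 ↔
      Z = !![Z 0 0, 0, Z 0 2; 0, -Z 0 0, Z 1 2; Z 1 2, Z 0 2, 0] := by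
  simp only [← Matrix.ext_iff, Fin.forall_fin_succ, hmat]
  simp [Matrix.mul_apply, vecMul, dotProduct, Fin.sum_univ_succ]
  grind

lemma sigmaMap_commutator {X Y : Matrix (Fin 4) (Fin 4) ℝ}
    (hX : Xᵀ * G4 + G4 * X = 0) (hY : Yᵀ * G4 + G4 * Y = 0) :
    sigmaMap (X * Y - Y * X) = sigmaMap X * sigmaMap Y - sigmaMap Y * sigmaMap X := by
  rw [transpose_mul_G4_add_eq_zero_iff] at hX hY
  have h2 : Real.sqrt 2 * Real.sqrt 2 = 2 := Real.mul_self_sqrt zero_le_two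
  rw [hX, hY]
  simp only [← Matrix.ext_iff, Fin.forall_fin_succ, sigmaMap]
  simp
  grind

lemma exists_sigmaMap_eq_iff (Z : Matrix (Fin 3) (Fin 3) ℝ) :
    (∃ X : Matrix (Fin 4) (Fin 4) ℝ, Xᵀ * G4 + G4 * X = 0 ∧ sigmaMap X = Z) ↔
      Zᵀ * hmat + hmat * Z = 0 := by
  rw [transpose_mul_hmat_add_eq_zero_iff]
  constructor
  · rintro ⟨X, -, rfl⟩
    simp [sigmaMap]
  · intro hZ
    have h2 : Real.sqrt 2 ≠ 0 := by positivity
    refine ⟨!![Z 0 0, Z 0 2 / Real.sqrt 2, 0, 0;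
               Z 1 2 / Real.sqrt 2, 0, 0, 0;
               0, 0, 0, Z 0 2 / Real.sqrt 2;
               0, 0, Z 1 2 / Real.sqrt 2, -Z 0 0], ?_, ?_⟩
    · simp [transpose_mul_G4_add_eq_zero_iff]
    · rw [hZ]
      simp [sigmaMap, mul_div_cancel₀ _ h2]

lemma sigmaMap_eq_zero_iff (X : Matrix (Fin 4) (Fin 4) ℝ) :
    sigmaMap X = 0 ↔ X 0 0 = X 1 1 ∧ X 0 1 = 0 ∧ X 1 0 = 0 := by
  simp only [← Matrix.ext_iff, Fin.forall_fin_succ, sigmaMap]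
  simp
  grind

/-- The representation of `𝔰𝔬(2,2)` on `Λ⁻`: (i) `σ` preserves Lie brackets on
`𝔤 = {X : XᵀG₄ + G₄X = 0}`; (ii) its image is exactly `𝔥 = {Y : Yᵀh + hY = 0}`;
(iii) its kernel is `{X(a,b,c,d,e,f) : a = d, b = c = 0}` (the second `𝔰𝔩(2,ℝ)` factor). -/
theorem stmt7 :
    (∀ X Y : Matrix (Fin 4) (Fin 4) ℝ,
      Xᵀ * G4 + G4 * X = 0 → Yᵀ * G4 + G4 * Y = 0 →
      sigmaMap (X * Y - Y * X) = sigmaMap X * sigmaMap Y - sigmaMap Y * sigmaMap X) ∧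
    (∀ Z : Matrix (Fin 3) (Fin 3) ℝ,
      (∃ X : Matrix (Fin 4) (Fin 4) ℝ, Xᵀ * G4 + G4 * X = 0 ∧ sigmaMap X = Z) ↔
        Zᵀ * hmat + hmat * Z = 0) ∧
    (∀ X : Matrix (Fin 4) (Fin 4) ℝ, Xᵀ * G4 + G4 * X = 0 →
      (sigmaMap X = 0 ↔ X 0 0 = X 1 1 ∧ X 0 1 = 0 ∧ X 1 0 = 0)) := by
  exact ⟨fun _ _ => sigmaMap_commutator, exists_sigmaMap_eq_iff,
    fun X _ => sigmaMap_eq_zero_iff X⟩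
end

section
/- Let p, q, r : ℝ⁴ → ℝ be smooth functions (coordinates x₀,x₁,x₂,x₃, ∂ᵢ = ∂/∂xᵢ). On ℝ⁵ with coordinates (x₀,x₁,x₂,x₃,ζ) define vector fields μ₁(x,ζ) = (1, ζ, (r(x)+ζq(x))/2, −(p(x)+ζr(x))/2, Q₁(x,ζ)) and μ₂(x,ζ) = (0,0,1,ζ,0), where Q₁(x,ζ) = −½∂₂p − (½∂₃p + ∂₂r)ζ − (½∂₂q + ∂₃r)ζ² − ½∂₃q·ζ³ (derivatives evaluated at x). Then the Lie bracket satisfies the identity [μ₁, μ₂](x,ζ) = A(x,ζ)·μ₂(x,ζ) − ((∂₂ + ζ∂₃)Q₁)(x,ζ)·(0,0,0,0,1), where A(x,ζ) = −½(∂₂r + ζ(∂₃r + ∂₂q) + ζ²∂₃q)(x). -/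
noncomputable section

/-- Partial derivative `∂ᵢ f` of a function on `ℝ⁴`. -/
def pd (f : (Fin 4 → ℝ) → ℝ) (i : Fin 4) (x : Fin 4 → ℝ) : ℝ :=
  fderiv ℝ f x (Pi.single i 1)

/-- `Q₁(x,ζ) = −½∂₂p − (½∂₃p + ∂₂r)ζ − (½∂₂q + ∂₃r)ζ² − ½∂₃q·ζ³`. -/
def Q1 (p q r : (Fin 4 → ℝ) → ℝ) (x : Fin 4 → ℝ) (ζ : ℝ) : ℝ :=
  -(1 / 2) * pd p 2 x - ((1 / 2) * pd p 3 x + pd r 2 x) * ζ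
    - ((1 / 2) * pd q 2 x + pd r 3 x) * ζ ^ 2 - (1 / 2) * pd q 3 x * ζ ^ 3

/-- The `ℝ⁴`-part of a point of `ℝ⁵ = ℝ⁴ × ℝ_ζ`. -/
def xpart (y : Fin 5 → ℝ) : Fin 4 → ℝ := ![y 0, y 1, y 2, y 3]

/-- `μ₁(x,ζ) = (1, ζ, (r+ζq)/2, −(p+ζr)/2, Q₁(x,ζ))`. -/
def mu1 (p q r : (Fin 4 → ℝ) → ℝ) (y : Fin 5 → ℝ) : Fin 5 → ℝ :=
  ![1, y 4, (r (xpart y) + y 4 * q (xpart y)) / 2,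
    -(p (xpart y) + y 4 * r (xpart y)) / 2, Q1 p q r (xpart y) (y 4)]

/-- `μ₂(x,ζ) = (0, 0, 1, ζ, 0)`. -/
def mu2 (y : Fin 5 → ℝ) : Fin 5 → ℝ := ![0, 0, 1, y 4, 0]

/-- Lie bracket of vector fields on `ℝ⁵`: `[V,W](y) = DW(y)·V(y) − DV(y)·W(y)`. -/
def lieBracket5 (V W : (Fin 5 → ℝ) → (Fin 5 → ℝ)) (y : Fin 5 → ℝ) : Fin 5 → ℝ :=
  fderiv ℝ W y (V y) - fderiv ℝ V y (W y)

theorem contDiff_pd {f : (Fin 4 → ℝ) → ℝ} (hf : ContDiff ℝ (⊤ : ℕ∞) f) (i : Fin 4) :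
    ContDiff ℝ (⊤ : ℕ∞) (pd f i) :=
  (hf.fderiv_right (m := (⊤ : ℕ∞)) (by norm_cast)).clm_apply contDiff_const

@[fun_prop]
theorem contDiff_xpart : ContDiff ℝ (⊤ : ℕ∞) xpart := by
  rw [contDiff_pi]
  intro i
  fin_cases i <;> simp [xpart] <;> fun_prop

theorem contDiff_Q1 {p q r : (Fin 4 → ℝ) → ℝ} (hp : ContDiff ℝ (⊤ : ℕ∞) p)
    (hq : ContDiff ℝ (⊤ : ℕ∞) q) (hr : ContDiff ℝ (⊤ : ℕ∞) r)
    {E : Type*} [NormedAddCommGroup E] [NormedSpace ℝ E] {u : E → Fin 4 → ℝ} {v : E → ℝ}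
    (hu : ContDiff ℝ (⊤ : ℕ∞) u) (hv : ContDiff ℝ (⊤ : ℕ∞) v) :
    ContDiff ℝ (⊤ : ℕ∞) (fun z => Q1 p q r (u z) (v z)) := by
  have hp2 := (contDiff_pd hp 2).comp hu
  have hp3 := (contDiff_pd hp 3).comp hu
  have hq2 := (contDiff_pd hq 2).comp hu
  have hq3 := (contDiff_pd hq 3).comp hu
  have hr2 := (contDiff_pd hr 2).comp hu
  have hr3 := (contDiff_pd hr 3).comp hu
  simp only [Function.comp_def] at hp2 hp3 hq2 hq3 hr2 hr3
  unfold Q1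
  fun_prop

theorem contDiff_mu1 {p q r : (Fin 4 → ℝ) → ℝ} (hp : ContDiff ℝ (⊤ : ℕ∞) p)
    (hq : ContDiff ℝ (⊤ : ℕ∞) q) (hr : ContDiff ℝ (⊤ : ℕ∞) r) :
    ContDiff ℝ (⊤ : ℕ∞) (mu1 p q r) := by
  have h4 : ContDiff ℝ (⊤ : ℕ∞) (fun y : Fin 5 → ℝ => y 4) := by fun_prop
  have hQ := contDiff_Q1 hp hq hr contDiff_xpart h4
  rw [contDiff_pi]
  intro i
  fin_cases i <;> simp [mu1] <;> fun_prop

theorem xpart_add_smul_mu2 (y : Fin 5 → ℝ) (t : ℝ) :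
    xpart (y + t • mu2 y) =
      xpart y + t • (Pi.single 2 1 + y 4 • Pi.single 3 1 : Fin 4 → ℝ) := by
  ext i
  fin_cases i <;> simp [xpart, mu2]

theorem fderiv_mu2_apply (y v : Fin 5 → ℝ) :
    fderiv ℝ mu2 y v = ![0, 0, 0, v 4, 0] := by
  have h : HasFDerivAt mu2
      (ContinuousLinearMap.pi
        ![0, 0, 0, ContinuousLinearMap.proj (R := ℝ) (φ := fun _ : Fin 5 => ℝ) 4, 0]) y := by
    rw [hasFDerivAt_pi']
    intro i
    fin_cases i
    · exact hasFDerivAt_const 0 y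
    · exact hasFDerivAt_const 0 y
    · exact hasFDerivAt_const 1 y
    · exact hasFDerivAt_apply (𝕜 := ℝ) (4 : Fin 5) y
    · exact hasFDerivAt_const 0 y
  rw [h.fderiv]
  ext i
  fin_cases i <;> simp

/-- Since `μ₂` has no `ζ`-component, differentiating along it acts as `∂₂ + ζ∂₃` with `ζ`
frozen. -/
theorem fderiv_apply_mu2 {G : (Fin 5 → ℝ) → ℝ} {F : (Fin 4 → ℝ) → ℝ → ℝ} {y : Fin 5 → ℝ}
    (hGF : ∀ z, G z = F (xpart z) (z 4)) (hG : DifferentiableAt ℝ G y)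
    (hF : DifferentiableAt ℝ (fun x => F x (y 4)) (xpart y)) :
    fderiv ℝ G y (mu2 y) =
      pd (fun x => F x (y 4)) 2 (xpart y) + y 4 * pd (fun x => F x (y 4)) 3 (xpart y) := by
  have h : lineDeriv ℝ G y (mu2 y) =
      lineDeriv ℝ (fun x => F x (y 4)) (xpart y) (Pi.single 2 1 + y 4 • Pi.single 3 1) := by
    unfold lineDeriv
    congr 1
    ext t
    rw [hGF, xpart_add_smul_mu2]
    simp [mu2]
  rw [hG.lineDeriv_eq_fderiv, hF.lineDeriv_eq_fderiv] at h
  simpa [pd] using h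

theorem pd_const (c : ℝ) (i : Fin 4) (x : Fin 4 → ℝ) : pd (fun _ => c) i x = 0 := by
  simp [pd]

theorem pd_const_mul_add_mul {f g : (Fin 4 → ℝ) → ℝ} {x : Fin 4 → ℝ}
    (hf : DifferentiableAt ℝ f x) (hg : DifferentiableAt ℝ g x) (c ζ : ℝ) (i : Fin 4) :
    pd (fun x => c * (f x + ζ * g x)) i x = c * (pd f i x + ζ * pd g i x) := by
  unfold pd
  rw [((hf.hasFDerivAt.fun_add (hg.hasFDerivAt.const_mul ζ)).const_mul c).fderiv]
  simp [mul_add]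

theorem fderiv_mu1_apply_mu2 {p q r : (Fin 4 → ℝ) → ℝ} (hp : ContDiff ℝ (⊤ : ℕ∞) p)
    (hq : ContDiff ℝ (⊤ : ℕ∞) q) (hr : ContDiff ℝ (⊤ : ℕ∞) r) (y : Fin 5 → ℝ) :
    fderiv ℝ (mu1 p q r) y (mu2 y) =
      ![0, 0,
        1 / 2 * ((pd r 2 (xpart y) + y 4 * pd q 2 (xpart y))
          + y 4 * (pd r 3 (xpart y) + y 4 * pd q 3 (xpart y))),
        -1 / 2 * ((pd p 2 (xpart y) + y 4 * pd r 2 (xpart y))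
          + y 4 * (pd p 3 (xpart y) + y 4 * pd r 3 (xpart y))),
        pd (fun x => Q1 p q r x (y 4)) 2 (xpart y)
          + y 4 * pd (fun x => Q1 p q r x (y 4)) 3 (xpart y)] := by
  have hμ : DifferentiableAt ℝ (mu1 p q r) y :=
    (contDiff_mu1 hp hq hr).differentiable (by simp) y
  have hμi : ∀ i, DifferentiableAt ℝ (fun z => mu1 p q r z i) y := differentiableAt_pi.1 hμ
  have dp := hp.differentiable (by simp) (xpart y)
  have dq := hq.differentiable (by simp) (xpart y)
  have dr := hr.differentiable (by simp) (xpart y)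
  have dQ : DifferentiableAt ℝ (fun x => Q1 p q r x (y 4)) (xpart y) :=
    (contDiff_Q1 hp hq hr contDiff_id contDiff_const).differentiable (by simp) _
  have hcomp : ∀ i, fderiv ℝ (mu1 p q r) y (mu2 y) i =
      fderiv ℝ (fun z => mu1 p q r z i) y (mu2 y) := fun i => by
    rw [fderiv_apply hμ]
    rfl
  ext i
  rw [hcomp]
  fin_cases i
  · rw [fderiv_apply_mu2 (F := fun _ _ => 1) (fun z => by simp [mu1]) (hμi _) (by fun_prop)]
    simp [pd_const]
  · rw [fderiv_apply_mu2 (F := fun _ ζ => ζ) (fun z => by simp [mu1]) (hμi _) (by fun_prop)]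
    simp [pd_const]
  · rw [fderiv_apply_mu2 (F := fun x ζ => 1 / 2 * (r x + ζ * q x))
      (fun z => by simp [mu1]; ring) (hμi _) (by fun_prop),
      pd_const_mul_add_mul dr dq, pd_const_mul_add_mul dr dq]
    simp
    ring
  · rw [fderiv_apply_mu2 (F := fun x ζ => -1 / 2 * (p x + ζ * r x))
      (fun z => by simp [mu1]; ring) (hμi _) (by fun_prop),
      pd_const_mul_add_mul dp dr, pd_const_mul_add_mul dp dr]
    simp
    ring
  · rw [fderiv_apply_mu2 (F := fun x ζ => Q1 p q r x ζ) (fun z => by simp [mu1]) (hμi _) dQ]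
    simp

/-- The bracket identity
`[μ₁,μ₂] = A·μ₂ − ((∂₂+ζ∂₃)Q₁)·∂ζ` with
`A = −½(∂₂r + ζ(∂₃r + ∂₂q) + ζ²∂₃q)`. -/
theorem stmt11 (p q r : (Fin 4 → ℝ) → ℝ)
    (hp : ContDiff ℝ (⊤ : ℕ∞) p) (hq : ContDiff ℝ (⊤ : ℕ∞) q) (hr : ContDiff ℝ (⊤ : ℕ∞) r) :
    ∀ y : Fin 5 → ℝ,
      lieBracket5 (mu1 p q r) mu2 y =
        (-(1 / 2) * (pd r 2 (xpart y) + y 4 * (pd r 3 (xpart y) + pd q 2 (xpart y))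
            + (y 4) ^ 2 * pd q 3 (xpart y))) • mu2 y
        - (pd (fun x => Q1 p q r x (y 4)) 2 (xpart y)
            + y 4 * pd (fun x => Q1 p q r x (y 4)) 3 (xpart y)) • (Pi.single 4 1 : Fin 5 → ℝ) := by
  intro y
  rw [lieBracket5, fderiv_mu2_apply, fderiv_mu1_apply_mu2 hp hq hr]
  ext i
  fin_cases i
  · simp [mu2]
  · simp [mu2]
  · simp [mu2]
    ring
  · simp [mu1, mu2, Q1]
    ring
  · simp [mu2]
end
end

section
/- Let p, q, r, K², K³, η : ℝ⁴ → ℝ be smooth functions satisfying the seven conformal Killing equations (∂₂K³ = 0, ∂₃K² = 0, ∂₂K² = η, ∂₃K³ = η, K²∂₂p + K³∂₃p + 2∂₀K³ = η·p, K²∂₂q + K³∂₃q − 2∂₁K² = η·q, K²∂₂r + K³∂₃r − ∂₀K² + ∂₁K³ = η·r) and suppose in addition ∂₂²p = 0 and ∂₃²q = 0. Then at every point: ∂₂η = 0, ∂₃η = 0, K³·∂₂∂₃p = 0, and K²·∂₂∂₃q = 0. -/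
noncomputable section

/-- Partial derivatives of a smooth function commute. -/
theorem pd_comm {f : (Fin 4 → ℝ) → ℝ} (hf : ContDiff ℝ (⊤ : ℕ∞) f) (i j : Fin 4)
    (x : Fin 4 → ℝ) : pd (pd f i) j x = pd (pd f j) i x := by
  have hd : DifferentiableAt ℝ (fderiv ℝ f) x :=
    (hf.fderiv_right (m := (⊤ : ℕ∞)) (by exact_mod_cast le_rfl)).differentiable (by simp) x
  have key : ∀ a b : Fin 4,
      pd (pd f a) b x = fderiv ℝ (fderiv ℝ f) x (Pi.single b 1) (Pi.single a 1) := by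
    intro a b
    have h : HasFDerivAt (pd f a) _ x :=
      hd.hasFDerivAt.clm_apply (hasFDerivAt_const (Pi.single a 1 : Fin 4 → ℝ) x)
    simp [pd, h.fderiv]
  rw [key, key]
  exact (hf.contDiffAt.isSymmSndFDerivAt (by simpa using (by exact_mod_cast le_top : ((2 : ℕ∞) : WithTop ℕ∞) ≤ (⊤ : ℕ∞)))).eq _ _

/-- The product rule for partial derivatives. -/
theorem pd_mul {f g : (Fin 4 → ℝ) → ℝ} {x : Fin 4 → ℝ} (hf : DifferentiableAt ℝ f x)
    (hg : DifferentiableAt ℝ g x) (i : Fin 4) :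
    pd (fun y => f y * g y) i x = pd f i x * g x + f x * pd g i x := by
  simp only [pd]
  rw [fderiv_fun_mul hf hg]
  simp
  ring

/-- Partial derivatives are additive. -/
theorem pd_add {f g : (Fin 4 → ℝ) → ℝ} {x : Fin 4 → ℝ} (hf : DifferentiableAt ℝ f x)
    (hg : DifferentiableAt ℝ g x) (i : Fin 4) :
    pd (fun y => f y + g y) i x = pd f i x + pd g i x := by
  simp only [pd]
  rw [fderiv_fun_add hf hg]
  simp

/-- If `∂ᵢf` vanishes identically, then so does `∂ᵢ∂ⱼf`. -/
theorem pd_pd_eq_zero {f : (Fin 4 → ℝ) → ℝ} (hf : ContDiff ℝ (⊤ : ℕ∞) f) {i : Fin 4}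
    (h : ∀ x, pd f i x = 0) (j : Fin 4) (x : Fin 4 → ℝ) : pd (pd f j) i x = 0 := by
  rw [pd_comm hf, show pd f i = fun _ => 0 from funext h, pd_const]

/-- The derivative along `∂ₖ` of an equation
`a ∂ᵢf + b ∂ⱼf + c ∂ₘg = η f`. -/
theorem pd_killing {f g a b η : (Fin 4 → ℝ) → ℝ} (hf : ContDiff ℝ (⊤ : ℕ∞) f)
    (hg : ContDiff ℝ (⊤ : ℕ∞) g) (ha : ContDiff ℝ (⊤ : ℕ∞) a) (hb : ContDiff ℝ (⊤ : ℕ∞) b)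
    (hη : ContDiff ℝ (⊤ : ℕ∞) η) (c : ℝ) (i j m k : Fin 4)
    (h : ∀ x, a x * pd f i x + b x * pd f j x + c * pd g m x = η x * f x) (x : Fin 4 → ℝ) :
    pd a k x * pd f i x + a x * pd (pd f i) k x + (pd b k x * pd f j x + b x * pd (pd f j) k x)
      + c * pd (pd g m) k x = pd η k x * f x + η x * pd f k x := by
  have d : ∀ {u : (Fin 4 → ℝ) → ℝ}, ContDiff ℝ (⊤ : ℕ∞) u → DifferentiableAt ℝ u x :=
    fun hu => hu.differentiable (by simp) x
  have hi := contDiff_pd hf i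
  have hj := contDiff_pd hf j
  have hm := contDiff_pd hg m
  have e := congrArg (fun u => pd u k x) (funext h)
  rw [pd_add (d ((ha.mul hi).add (hb.mul hj))) (d (contDiff_const.mul hm)),
    pd_add (d (ha.mul hi)) (d (hb.mul hj)), pd_mul (d ha) (d hi), pd_mul (d hb) (d hj),
    pd_mul (d contDiff_const) (d hm), pd_mul (d hη) (d hf), pd_const] at e
  linarith

/-- From the seven conformal Killing equations together with `∂₂²p = 0` and `∂₃²q = 0`
one deduces `∂₂η = ∂₃η = 0`, `K³·∂₂∂₃p = 0` and `K²·∂₂∂₃q = 0` at every point. -/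
theorem stmt15 (p q r K2 K3 η : (Fin 4 → ℝ) → ℝ)
    (hp : ContDiff ℝ (⊤ : ℕ∞) p) (hq : ContDiff ℝ (⊤ : ℕ∞) q) (hr : ContDiff ℝ (⊤ : ℕ∞) r)
    (hK2 : ContDiff ℝ (⊤ : ℕ∞) K2) (hK3 : ContDiff ℝ (⊤ : ℕ∞) K3) (hη : ContDiff ℝ (⊤ : ℕ∞) η)
    (hkill : ∀ x : Fin 4 → ℝ,
      pd K3 2 x = 0 ∧
      pd K2 3 x = 0 ∧
      pd K2 2 x = η x ∧
      pd K3 3 x = η x ∧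
      K2 x * pd p 2 x + K3 x * pd p 3 x + 2 * pd K3 0 x = η x * p x ∧
      K2 x * pd q 2 x + K3 x * pd q 3 x - 2 * pd K2 1 x = η x * q x ∧
      K2 x * pd r 2 x + K3 x * pd r 3 x - pd K2 0 x + pd K3 1 x = η x * r x)
    (hp22 : ∀ x : Fin 4 → ℝ, pd (pd p 2) 2 x = 0)
    (hq33 : ∀ x : Fin 4 → ℝ, pd (pd q 3) 3 x = 0) :
    ∀ x : Fin 4 → ℝ,
      pd η 2 x = 0 ∧ pd η 3 x = 0 ∧
      K3 x * pd (pd p 3) 2 x = 0 ∧ K2 x * pd (pd q 3) 2 x = 0 := by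
  have e1 := fun x => (hkill x).1
  have e2 := fun x => (hkill x).2.1
  have e3 := fun x => (hkill x).2.2.1
  have e4 := fun x => (hkill x).2.2.2.1
  have hη2 : ∀ x, pd η 2 x = 0 := by
    rw [← show pd K3 3 = η from funext e4]
    exact pd_pd_eq_zero hK3 e1 3
  have hη3 : ∀ x, pd η 3 x = 0 := by
    rw [← show pd K2 2 = η from funext e3]
    exact pd_pd_eq_zero hK2 e2 2
  intro x
  refine ⟨hη2 x, hη3 x, ?_, ?_⟩
  · have h := pd_killing hp hK3 hK2 hK3 hη 2 2 3 0 2 (fun y => (hkill y).2.2.2.2.1) x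
    rw [e1, e3, hp22, hη2, pd_pd_eq_zero hK3 e1] at h
    linarith
  · have h := pd_killing hq hK2 hK2 hK3 hη (-2) 2 3 1 3
      (fun y => by linarith [(hkill y).2.2.2.2.2.1]) x
    rw [e2, e4, hq33, hη3, pd_pd_eq_zero hK2 e2, pd_comm hq] at h
    linarith
end
end
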